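/- Let E ⊆ ℂⁿ be a compact set that is the countable union of compact sets E_k, each of which satisfies property (P): for every M > 0 there is a plurisubharmonic function λ on a neighborhood of E_k with 0 ≤ λ ≤ 1 whose complex Hessian at every point of E_k has all eigenvalues at least M. Then E itself satisfies property (P). -/

import Mathlib

open Complex

/-- The Levi form (complex Hessian quadratic form) of a real-valued function `f` on a complex
normed space, at the point `z` in the direction `w`:
`Σ (∂²f/∂z_j∂z̄_k)(z) w_j w̄_k = (1/4)(D²f(z)(w,w) + D²f(z)(iw,iw))`,
where `D²` is the real second Fréchet derivative. -/
noncomputable def leviForm {X : Type*} [NormedAddCommGroup X] [NormedSpace ℂ X]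
    (f : X → ℝ) (z w : X) : ℝ :=
  (1 / 4) * (iteratedFDeriv ℝ 2 f z ![w, w] + iteratedFDeriv ℝ 2 f z ![I • w, I • w])

/-- Catlin's property (P) for a compact set `E` in a complex normed space: for every `M > 0`
there is a `C²` function `λ`, plurisubharmonic on a neighborhood `U` of `E` and with values in
`[0,1]` there, whose complex Hessian has all eigenvalues at least `M` at every point of `E`. -/
def PropertyP {X : Type*} [NormedAddCommGroup X] [NormedSpace ℂ X] (E : Set X) : Prop :=
  ∀ M > (0 : ℝ), ∃ (U : Set X) (f : X → ℝ),
    IsOpen U ∧ E ⊆ U ∧ ContDiff ℝ 2 f ∧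
    (∀ z ∈ U, f z ∈ Set.Icc (0 : ℝ) 1) ∧
    (∀ z ∈ U, ∀ w : X, 0 ≤ leviForm f z w) ∧
    (∀ z ∈ E, ∀ w : X, M * ‖w‖ ^ 2 ≤ leviForm f z w)

section LeviForm

open Filter Topology

variable {X : Type*} [NormedAddCommGroup X] [NormedSpace ℂ X]

theorem leviForm_congr {f g : X → ℝ} {z : X} (h : f =ᶠ[𝓝 z] g) (w : X) :
    leviForm f z w = leviForm g z w := by
  simp only [leviForm, (h.iteratedFDeriv ℝ 2).eq_of_nhds]

theorem leviForm_const (c : ℝ) (z w : X) : leviForm (fun _ ↦ c) z w = 0 := by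
  simp [leviForm, iteratedFDeriv_two_apply]

theorem leviForm_add {f g : X → ℝ} (hf : ContDiff ℝ 2 f) (hg : ContDiff ℝ 2 g) (z w : X) :
    leviForm (fun x ↦ f x + g x) z w = leviForm f z w + leviForm g z w := by
  have h : iteratedFDeriv ℝ 2 (fun x ↦ f x + g x) z =
      iteratedFDeriv ℝ 2 f z + iteratedFDeriv ℝ 2 g z :=
    iteratedFDeriv_add_apply hf.contDiffAt hg.contDiffAt
  simp only [leviForm, h, add_apply]
  ring

theorem leviForm_const_mul {f : X → ℝ} (hf : ContDiff ℝ 2 f) (c : ℝ) (z w : X) :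
    leviForm (fun x ↦ c * f x) z w = c * leviForm f z w := by
  have h : iteratedFDeriv ℝ 2 (fun x ↦ c * f x) z = c • iteratedFDeriv ℝ 2 f z :=
    iteratedFDeriv_const_smul_apply (a := c) (f := f) (x := z) (i := 2) hf.contDiffAt
  simp only [leviForm, h, smul_apply, smul_eq_mul]
  ring

theorem abs_leviForm_sub_le (f g : X → ℝ) (y z w : X) :
    |leviForm f y w - leviForm g z w| ≤
      1 / 2 * ‖iteratedFDeriv ℝ 2 f y - iteratedFDeriv ℝ 2 g z‖ * ‖w‖ ^ 2 := by
  set A := iteratedFDeriv ℝ 2 f y - iteratedFDeriv ℝ 2 g z with hA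
  have h : leviForm f y w - leviForm g z w = 1 / 4 * (A ![w, w] + A ![I • w, I • w]) := by
    simp only [leviForm, hA, sub_apply]
    ring
  have h1 := A.le_opNorm ![w, w]
  have h2 := A.le_opNorm ![I • w, I • w]
  simp only [Fin.prod_univ_two, Matrix.cons_val_zero, Matrix.cons_val_one, norm_smul, norm_I,
    one_mul, Real.norm_eq_abs] at h1 h2
  rw [h, abs_mul, abs_of_pos (by norm_num : (0 : ℝ) < 1 / 4)]
  have h3 := abs_add_le (A ![w, w]) (A ![I • w, I • w])
  nlinarith

theorem abs_leviForm_le (f : X → ℝ) (z w : X) :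
    |leviForm f z w| ≤ 1 / 2 * ‖iteratedFDeriv ℝ 2 f z‖ * ‖w‖ ^ 2 := by
  have h0 : iteratedFDeriv ℝ 2 (fun _ : X ↦ (0 : ℝ)) z = 0 := by
    simp
  have h := abs_leviForm_sub_le f (fun _ ↦ 0) z z w
  rwa [leviForm_const, h0, sub_zero, sub_zero] at h

/-- A strict lower bound on the Levi form at a point persists, slightly weakened, nearby. -/
theorem eventually_le_leviForm {f : X → ℝ} (hf : ContDiff ℝ 2 f) {M M' : ℝ} (hM : M < M') {z : X}
    (h : ∀ w, M' * ‖w‖ ^ 2 ≤ leviForm f z w) :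
    ∀ᶠ y in 𝓝 z, ∀ w, M * ‖w‖ ^ 2 ≤ leviForm f y w := by
  have hc : Continuous (iteratedFDeriv ℝ 2 f) := hf.continuous_iteratedFDeriv (by norm_num)
  filter_upwards [Metric.tendsto_nhds.1 (hc.tendsto z) (M' - M) (sub_pos.2 hM)] with y hy w
  rw [dist_eq_norm] at hy
  have h1 := (abs_le.1 (abs_leviForm_sub_le f f y z w)).1
  have h2 := h w
  have h3 : 0 ≤ ‖w‖ ^ 2 := by positivity
  nlinarith [norm_nonneg (iteratedFDeriv ℝ 2 f y - iteratedFDeriv ℝ 2 f z)]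

/-- Composing with a convex function contributes a nonnegative term to the Levi form. -/
theorem deriv_mul_leviForm_le {f : X → ℝ} (hf : ContDiff ℝ 2 f) {H : ℝ → ℝ} (hH : ContDiff ℝ 2 H)
    {z : X} (hconv : 0 ≤ deriv (deriv H) (f z)) (w : X) :
    deriv H (f z) * leviForm f z w ≤ leviForm (fun x ↦ H (f x)) z w := by
  have hfd : Differentiable ℝ f := hf.differentiable (by norm_num)
  have hHd : Differentiable ℝ H := hH.differentiable (by norm_num)
  have hfd' : Differentiable ℝ (fderiv ℝ f) :=
    (hf.fderiv_right (m := 1) (by norm_num)).differentiable (by norm_num)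
  have hHd' : Differentiable ℝ (deriv H) := by
    have : ContDiff ℝ (1 + 1) H := by convert! hH using 1
    exact (contDiff_succ_iff_deriv.1 this).2.2.differentiable (by norm_num)
  have h1 : fderiv ℝ (fun x ↦ H (f x)) = fun x ↦ deriv H (f x) • fderiv ℝ f x := by
    ext1 x
    exact ((hHd (f x)).hasDerivAt.comp_hasFDerivAt x (hfd x).hasFDerivAt).fderiv
  have h2 : fderiv ℝ (fderiv ℝ fun x ↦ H (f x)) z =
      deriv H (f z) • fderiv ℝ (fderiv ℝ f) z +
        (deriv (deriv H) (f z) • fderiv ℝ f z).smulRight (fderiv ℝ f z) := by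
    rw [h1]
    exact (((hHd' (f z)).hasDerivAt.comp_hasFDerivAt z (hfd z).hasFDerivAt).smul
      (hfd' z).hasFDerivAt).fderiv
  simp only [leviForm, iteratedFDeriv_two_apply, h2, Matrix.cons_val_zero, Matrix.cons_val_one,
    add_apply, smul_apply,
    ContinuousLinearMap.smulRight_apply, smul_eq_mul]
  nlinarith [mul_nonneg hconv (mul_self_nonneg (fderiv ℝ f z w)),
    mul_nonneg hconv (mul_self_nonneg (fderiv ℝ f z (I • w)))]

end LeviForm

/-- A `C²` convex regularization of `x ↦ max x 0`, up to an additive constant for large `x`. -/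
theorem exists_convex_regularization {δ : ℝ} (hδ : 0 < δ) :
    ∃ (H : ℝ → ℝ) (c : ℝ), ContDiff ℝ 2 H ∧ (∀ x ≤ 0, H x = 0) ∧ (∀ x ≥ δ, H x = x - c) ∧
      (∀ x, 0 ≤ H x) ∧ (∀ x, H x ≤ max x 0) ∧ (∀ x, deriv H x ∈ Set.Icc (0 : ℝ) 1) ∧
      ∀ x, 0 ≤ deriv (deriv H) x := by
  set S : ℝ → ℝ := fun t ↦ Real.smoothTransition (t / δ) with hS
  have hSd : ContDiff ℝ 1 S :=
    (Real.smoothTransition.contDiff (n := 1)).comp (contDiff_id.div_const δ)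
  have hSc : Continuous S := hSd.continuous
  have hSm : Monotone S := fun a b hab ↦
    Real.smoothTransition.monotone (by gcongr)
  have hS0 : ∀ t, 0 ≤ S t := fun t ↦ Real.smoothTransition.nonneg _
  have hS1 : ∀ t, S t ≤ 1 := fun t ↦ Real.smoothTransition.le_one _
  have hint : ∀ a b, IntervalIntegrable S MeasureTheory.volume a b :=
    fun a b ↦ hSc.intervalIntegrable a b
  set H : ℝ → ℝ := fun x ↦ ∫ t in (0 : ℝ)..x, S t with hH
  have hHS : ∀ x, HasDerivAt H (S x) x := fun x ↦ hSc.integral_hasStrictDerivAt 0 x |>.hasDerivAt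
  have hder : deriv H = S := funext fun x ↦ (hHS x).deriv
  have hneg : ∀ x ≤ 0, H x = 0 := by
    intro x hx
    have : ∫ t in (0 : ℝ)..x, S t = ∫ t in (0 : ℝ)..x, (0 : ℝ) := by
      refine intervalIntegral.integral_congr fun t ht ↦ ?_
      rw [Set.uIcc_of_ge hx] at ht
      exact Real.smoothTransition.zero_of_nonpos (div_nonpos_of_nonpos_of_nonneg ht.2 hδ.le)
    simpa using this
  refine ⟨H, δ - H δ, ?_, hneg, ?_, ?_, ?_, ?_, ?_⟩
  · have : ContDiff ℝ (1 + 1) H := contDiff_succ_iff_deriv.2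
      ⟨fun x ↦ (hHS x).differentiableAt, by simp, by rwa [hder]⟩
    convert! this using 1
  · intro x hx
    have h1 : ∫ t in δ..x, S t = ∫ t in δ..x, (1 : ℝ) := by
      refine intervalIntegral.integral_congr fun t ht ↦ ?_
      rw [Set.uIcc_of_le hx] at ht
      exact Real.smoothTransition.one_of_one_le ((one_le_div hδ).2 ht.1)
    have h2 : H δ + ∫ t in δ..x, S t = H x :=
      intervalIntegral.integral_add_adjacent_intervals (hint _ _) (hint _ _)
    rw [h1, intervalIntegral.integral_const, smul_eq_mul] at h2
    linarith
  · intro x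
    rcases le_total x 0 with hx | hx
    · exact (hneg x hx).ge
    · exact intervalIntegral.integral_nonneg hx fun t _ ↦ hS0 t
  · intro x
    rcases le_total x 0 with hx | hx
    · exact (hneg x hx).le.trans (le_max_right _ _)
    · refine le_max_of_le_left ?_
      have := intervalIntegral.integral_mono_on hx (hint 0 x)
        (intervalIntegrable_const (c := (1 : ℝ))) fun t _ ↦ hS1 t
      simpa using this
  · intro x
    rw [hder]
    exact ⟨hS0 x, hS1 x⟩
  · intro x
    rw [hder]
    exact hSm.deriv_nonneg

section Patching

open Filter Topology

variable {X : Type*} [NormedAddCommGroup X] [NormedSpace ℂ X]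

theorem exists_contDiff_cutoff [FiniteDimensional ℂ X] {K O : Set X} (hK : IsClosed K)
    (hO : IsOpen O) (hKO : K ⊆ O) :
    ∃ φ : X → ℝ, ContDiff ℝ 2 φ ∧ (∀ᶠ x in 𝓝ˢ K, φ x = 1) ∧ (∀ x ∉ O, φ x = 0) ∧
      ∀ x, φ x ∈ Set.Icc (0 : ℝ) 1 := by
  have := FiniteDimensional.complexToReal X
  obtain ⟨φ, h1, h0, h01⟩ := exists_contMDiffMap_one_nhds_of_subset_interior (n := 2)
    (modelWithCornersSelf ℝ X) hK (hKO.trans hO.interior_eq.ge)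
  exact ⟨φ, φ.contMDiff.contDiff, h1, h0, h01⟩

/-- On a compact set with property (P), every `C²` function becomes plurisubharmonic with a large
Levi form after adding an arbitrarily small nonnegative perturbation. -/
theorem PropertyP.exists_perturbation [FiniteDimensional ℂ X] {F : Set X} (hF : IsCompact F)
    (hP : PropertyP F) {φ : X → ℝ} (hφ : ContDiff ℝ 2 φ) {δ : ℝ} (hδ : 0 < δ) (M : ℝ) :
    ∃ v : X → ℝ, ContDiff ℝ 2 v ∧ (∀ x, φ x ≤ v x) ∧ (∀ x, v x ≤ φ x + δ) ∧
      ∀ z ∈ F, ∀ w, M * ‖w‖ ^ 2 ≤ leviForm v z w := by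
  obtain ⟨B, hB⟩ := hF.exists_bound_of_continuousOn
    (hφ.continuous_iteratedFDeriv (m := 2) (by norm_num)).continuousOn
  obtain ⟨U, f, hU, hFU, hf, hf01, -, hfM⟩ :=
    hP (max ((M + B) / δ) 1) (lt_max_of_lt_right one_pos)
  obtain ⟨χ, hχ, hχ1, hχ0, hχ01⟩ := exists_contDiff_cutoff hF.isClosed hU hFU
  have hχf : ContDiff ℝ 2 fun x ↦ χ x * f x := hχ.mul hf
  have h01 : ∀ x, χ x * f x ∈ Set.Icc (0 : ℝ) 1 := by
    intro x
    by_cases hx : x ∈ U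
    · exact ⟨mul_nonneg (hχ01 x).1 (hf01 x hx).1,
        mul_le_one₀ (hχ01 x).2 (hf01 x hx).1 (hf01 x hx).2⟩
    · simp [hχ0 x hx]
  refine ⟨fun x ↦ φ x + δ * (χ x * f x), hφ.add (contDiff_const.mul hχf), fun x ↦ ?_, fun x ↦ ?_,
    fun z hz w ↦ ?_⟩
  · exact le_add_of_nonneg_right (mul_nonneg hδ.le (h01 x).1)
  · have := mul_le_of_le_one_right hδ.le (h01 x).2
    linarith
  · have hloc : (fun x ↦ χ x * f x) =ᶠ[𝓝 z] f := by
      filter_upwards [eventually_nhdsSet_iff_forall.1 hχ1 z hz] with x hx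
      rw [hx, one_mul]
    rw [leviForm_add hφ (contDiff_const.mul hχf), leviForm_const_mul hχf, leviForm_congr hloc]
    have h1 := hfM z hz w
    have h2 := (abs_le.1 (abs_leviForm_le φ z w)).1
    have h3 : 0 ≤ ‖w‖ ^ 2 := by positivity
    have h4 : M + B ≤ δ * max ((M + B) / δ) 1 := by
      rw [← div_le_iff₀' hδ]
      exact le_max_left _ _
    have h5 : δ * (max ((M + B) / δ) 1 * ‖w‖ ^ 2) ≤ δ * leviForm f z w := by gcongr
    have h6 := mul_le_mul_of_nonneg_right h4 h3
    have h7 := mul_le_mul_of_nonneg_right (hB z hz) h3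
    have h8 : 0 ≤ ‖iteratedFDeriv ℝ 2 φ z‖ * ‖w‖ ^ 2 := by positivity
    linarith

/-- A regularized maximum of two functions satisfies the lower Levi bounds they share. -/
theorem le_leviForm_regularized_max {u v : X → ℝ} (hu : ContDiff ℝ 2 u) (hv : ContDiff ℝ 2 v)
    {H : ℝ → ℝ} (hH : ContDiff ℝ 2 H) {z : X} (hH1 : deriv H (u z - v z) ∈ Set.Icc (0 : ℝ) 1)
    (hH2 : 0 ≤ deriv (deriv H) (u z - v z)) {m : ℝ} {w : X} (hum : m ≤ leviForm u z w)
    (hvm : m ≤ leviForm v z w) :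
    m ≤ leviForm (fun x ↦ v x + H (u x - v x)) z w := by
  have hd : ContDiff ℝ 2 fun x ↦ u x - v x := hu.sub hv
  have hsum : leviForm u z w = leviForm (fun x ↦ u x - v x) z w + leviForm v z w := by
    simpa only [sub_add_cancel] using leviForm_add hd hv z w
  have hHd : ContDiff ℝ 2 fun x ↦ H (u x - v x) := hH.comp hd
  rw [leviForm_add hv hHd]
  have h := deriv_mul_leviForm_le hd hH hH2 w
  rw [← sub_eq_iff_eq_add.2 hsum] at h
  linarith [mul_le_mul_of_nonneg_left hum hH1.1,
    mul_le_mul_of_nonneg_left hvm (sub_nonneg.2 hH1.2)]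

/-- A bounded function with Levi form at least `M` near a compact set `K` can be replaced by one
with the same property near `K ∪ F`, where `F` is a compact set with property (P), at the cost of
an arbitrarily small increase of the bound. -/
theorem exists_le_leviForm_union [FiniteDimensional ℂ X] {K F : Set X} (hK : IsCompact K)
    (hF : IsCompact F) (hP : PropertyP F) {M b δ : ℝ} (hδ : 0 < δ) {u : X → ℝ}
    (hu : ContDiff ℝ 2 u) (hub : ∀ x, |u x| ≤ b)
    (huK : K ⊆ interior {z | ∀ w, M * ‖w‖ ^ 2 ≤ leviForm u z w}) :
    ∃ g : X → ℝ, ContDiff ℝ 2 g ∧ (∀ x, |g x| ≤ b + δ) ∧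
      K ∪ F ⊆ interior {z | ∀ w, M * ‖w‖ ^ 2 ≤ leviForm g z w} := by
  obtain ⟨ε, hε, rfl⟩ : ∃ ε > 0, δ = 3 * ε := ⟨δ / 3, by positivity, by ring⟩
  obtain ⟨φ, hφ, hφ1, hφ0, hφ01⟩ := exists_contDiff_cutoff hK.isClosed isOpen_interior huK
  have hψ : ContDiff ℝ 2 fun x ↦ (b + ε) - (2 * b + 4 * ε) * φ x :=
    contDiff_const.sub (contDiff_const.mul hφ)
  obtain ⟨v, hv, hv1, hv2, hvM⟩ := hP.exists_perturbation hF hψ hε (M + 1)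
  obtain ⟨H, c, hH, hHneg, hHpos, hH0, hHmax, hH1, hH2⟩ := exists_convex_regularization hε
  have hg : ContDiff ℝ 2 fun x ↦ v x + H (u x - v x) := hv.add (hH.comp (hu.sub hv))
  have hcont : Continuous fun x ↦ u x - v x := hu.continuous.sub hv.continuous
  refine ⟨_, hg, fun x ↦ ?_, ?_⟩
  · obtain ⟨hu1, hu2⟩ := abs_le.1 (hub x)
    have hlow : -(b + 3 * ε) ≤ v x := by
      nlinarith [hv1 x, (hφ01 x).2]
    have hupp : v x ≤ b + 2 * ε := by
      nlinarith [hv2 x, (hφ01 x).1]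
    rw [abs_le]
    refine ⟨by linarith [hH0 (u x - v x)], ?_⟩
    rcases le_total (u x - v x) 0 with h | h
    · rw [hHneg _ h]
      linarith
    · have := hHmax (u x - v x)
      rw [max_eq_left h] at this
      linarith
  · rintro z (hz | hz) <;> rw [mem_interior_iff_mem_nhds]
    · have hzd : ε < u z - v z := by
        have h1 := hv2 z
        rw [(eventually_nhdsSet_iff_forall.1 hφ1 z hz).self_of_nhds] at h1
        linarith [(abs_le.1 (hub z)).1]
      filter_upwards [(hcont.tendsto z).eventually_const_lt hzd |>.eventually_nhds,
        mem_interior_iff_mem_nhds.1 (huK hz)] with y hy huy w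
      have hloc : (fun x ↦ v x + H (u x - v x)) =ᶠ[𝓝 y] fun x ↦ u x + -c := by
        filter_upwards [hy] with x hx
        rw [hHpos _ hx.le]
        ring
      rw [leviForm_congr hloc, leviForm_add hu contDiff_const, leviForm_const, add_zero]
      exact huy w
    · have hvz := eventually_le_leviForm hv (lt_add_one M) (hvM z hz)
      by_cases hzO : z ∈ interior {z | ∀ w, M * ‖w‖ ^ 2 ≤ leviForm u z w}
      · filter_upwards [hvz, mem_interior_iff_mem_nhds.1 hzO] with y hvy huy w
        exact le_leviForm_regularized_max hu hv hH (hH1 _) (hH2 _) (huy w) (hvy w)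
      · have hzd : u z - v z < 0 := by
          have h1 := hv1 z
          simp only [hφ0 z hzO] at h1
          linarith [(abs_le.1 (hub z)).2]
        filter_upwards [(hcont.tendsto z).eventually_lt_const hzd |>.eventually_nhds,
          hvz] with y hy hvy w
        have hloc : (fun x ↦ v x + H (u x - v x)) =ᶠ[𝓝 y] v := by
          filter_upwards [hy] with x hx
          rw [hHneg _ hx.le, add_zero]
        rw [leviForm_congr hloc]
        exact hvy w

theorem PropertyP.of_eq_iUnion [FiniteDimensional ℂ X] {E : Set X} {F : ℕ → Set X}
    (hE : E = ⋃ k, F k) (hEcpt : IsCompact E) (hF : ∀ k, IsCompact (F k))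
    (hP : ∀ k, PropertyP (F k)) : PropertyP E := by
  intro M hM
  have := FiniteDimensional.proper ℂ X
  let Q : ℕ → Set X → Prop := fun k K ↦ IsCompact K ∧ ∃ u : X → ℝ, ContDiff ℝ 2 u ∧
    (∀ x, |u x| ≤ 1 / 2 - (1 / 2) ^ (k + 1)) ∧
    K ⊆ interior {z | ∀ w, M * ‖w‖ ^ 2 ≤ leviForm u z w}
  have hQ0 : Q 0 ∅ := ⟨isCompact_empty, fun _ ↦ 0, contDiff_const, by norm_num, Set.empty_subset _⟩
  have hstep : ∀ k K, Q k K → ∃ K', Q (k + 1) K' ∧ K ∪ F k ⊆ interior K' := by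
    rintro k K ⟨hK, u, hu, hub, huK⟩
    obtain ⟨g, hg, hgb, hgK⟩ := exists_le_leviForm_union hK (hF k) (hP k)
      (δ := (1 / 2) ^ (k + 2)) (by positivity) hu hub huK
    obtain ⟨K', hK', hsub, hK'g⟩ := exists_compact_between (hK.union (hF k)) isOpen_interior hgK
    refine ⟨K', ⟨hK', g, hg, fun x ↦ (hgb x).trans_eq ?_, hK'g⟩, hsub⟩
    ring
  choose next hnextQ hnext using hstep
  let K : ∀ k, {K // Q k K} := fun k ↦
    Nat.rec ⟨∅, hQ0⟩ (fun k K ↦ ⟨next k K.1 K.2, hnextQ k K.1 K.2⟩) k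
  have hKsucc : ∀ k, (K k).1 ∪ F k ⊆ interior (K (k + 1)).1 := fun k ↦ hnext k _ _
  have hmono : Monotone fun k ↦ interior (K k).1 := monotone_nat_of_le_succ fun k ↦
    interior_subset.trans (Set.subset_union_left.trans (hKsucc k))
  obtain ⟨N, hN⟩ := hEcpt.elim_directed_cover (fun k ↦ interior (K k).1)
    (fun _ ↦ isOpen_interior)
    (hE.le.trans (Set.iUnion_subset fun k ↦ (Set.subset_union_right.trans (hKsucc k)).trans
      (Set.subset_iUnion (fun k ↦ interior (K k).1) (k + 1))))
    hmono.directed_le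
  obtain ⟨-, u, hu, hub, huK⟩ := (K N).2
  have hlevi : ∀ z ∈ interior (K N).1, ∀ w,
      M * ‖w‖ ^ 2 ≤ leviForm (fun x ↦ u x + 1 / 2) z w := by
    intro z hz w
    rw [leviForm_add hu contDiff_const, leviForm_const, add_zero]
    exact interior_subset (huK (interior_subset hz)) w
  refine ⟨interior (K N).1, fun x ↦ u x + 1 / 2, isOpen_interior, hN, hu.add contDiff_const,
    fun z _ ↦ ?_, fun z hz w ↦ le_trans (by positivity) (hlevi z hz w),
    fun z hz w ↦ hlevi z (hN hz) w⟩
  have hpow : (0 : ℝ) < (1 / 2) ^ (N + 1) := by positivity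
  obtain ⟨h1, h2⟩ := abs_le.1 (hub z)
  exact ⟨by linarith, by linarith⟩

end Patching

/-- A compact countable union of compact sets satisfying property (P) in `ℂⁿ` satisfies
property (P). -/
theorem propertyP_of_countable_union {n : ℕ}
    (E : Set (EuclideanSpace ℂ (Fin n))) (Ek : ℕ → Set (EuclideanSpace ℂ (Fin n)))
    (hE : E = ⋃ k, Ek k) (hEcpt : IsCompact E)
    (hEk : ∀ k, IsCompact (Ek k) ∧ PropertyP (Ek k)) :
    PropertyP E :=
  PropertyP.of_eq_iUnion hE hEcpt (fun k ↦ (hEk k).1) fun k ↦ (hEk k).2
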